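/- arXiv:2404.00962 — 7 statements merged into one kernel-verified Lean document; each statement's English description precedes it below -/
import Mathlib

section
/- Let N, F, d, k be natural numbers and write E = EuclideanSpace ℝ (Fin 3). Suppose φ₀ : (Fin F → E) × (Fin F → (Fin k → ℝ)) → ℝ, q : ((Fin F → E) × (Fin F → (Fin d → ℝ))) → ((Fin F → E) × (Fin F → (Fin k → ℝ))) → ℝ, and p : ((Fin F → E) × (Fin F → (Fin k → ℝ))) → ((Fin N → E) × (Fin N → (Fin d → ℝ))) → ℝ are measurable and satisfy, for every rotation R and all arguments: φ₀ (R ∘ fx, fh) = φ₀ (fx, fh); q (R ∘ xf, hf) (R ∘ fx, fh) = q (xf, hf) (fx, fh); and p (R ∘ fx, fh) (R ∘ x, h) = p (fx, fh) (x, h). Define the autoencoder loss L (x, h, xf, hf) = (∫ q (xf, hf) f • Real.log (p f (x, h)) df) − (∫ q (xf, hf) f • Real.log (q (xf, hf) f / φ₀ f) df), where both Bochner integrals are over the latent space (Fin F → E) × (Fin F → (Fin k → ℝ)) with respect to Lebesgue (volume) measure. Then for every rotation R and all x, h, xf, hf, one has L (R ∘ x, h, R ∘ xf, hf) = L (x,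 h, xf, hf). -/
open MeasureTheory

/-- SE(3)-invariance (rotation part) of the equivariant asymmetric
autoencoder loss. -/
theorem eaae_loss_rotation_invariant (N F d k : ℕ)
    (φ₀ : (Fin F → EuclideanSpace ℝ (Fin 3)) × (Fin F → (Fin k → ℝ)) → ℝ)
    (q : ((Fin F → EuclideanSpace ℝ (Fin 3)) × (Fin F → (Fin d → ℝ))) →
      ((Fin F → EuclideanSpace ℝ (Fin 3)) × (Fin F → (Fin k → ℝ))) → ℝ)
    (p : ((Fin F → EuclideanSpace ℝ (Fin 3)) × (Fin F → (Fin k → ℝ))) →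
      ((Fin N → EuclideanSpace ℝ (Fin 3)) × (Fin N → (Fin d → ℝ))) → ℝ)
    (hφ₀ : Measurable φ₀)
    (hq : Measurable (Function.uncurry q))
    (hp : Measurable (Function.uncurry p))
    (hφ₀inv : ∀ (R : EuclideanSpace ℝ (Fin 3) ≃ₗᵢ[ℝ] EuclideanSpace ℝ (Fin 3))
      (fx : Fin F → EuclideanSpace ℝ (Fin 3)) (fh : Fin F → (Fin k → ℝ)),
      φ₀ (⇑R ∘ fx, fh) = φ₀ (fx, fh))
    (hqequiv : ∀ (R : EuclideanSpace ℝ (Fin 3) ≃ₗᵢ[ℝ] EuclideanSpace ℝ (Fin 3))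
      (xf : Fin F → EuclideanSpace ℝ (Fin 3)) (hf : Fin F → (Fin d → ℝ))
      (fx : Fin F → EuclideanSpace ℝ (Fin 3)) (fh : Fin F → (Fin k → ℝ)),
      q (⇑R ∘ xf, hf) (⇑R ∘ fx, fh) = q (xf, hf) (fx, fh))
    (hpequiv : ∀ (R : EuclideanSpace ℝ (Fin 3) ≃ₗᵢ[ℝ] EuclideanSpace ℝ (Fin 3))
      (fx : Fin F → EuclideanSpace ℝ (Fin 3)) (fh : Fin F → (Fin k → ℝ))
      (x : Fin N → EuclideanSpace ℝ (Fin 3)) (h : Fin N → (Fin d → ℝ)),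
      p (⇑R ∘ fx, fh) (⇑R ∘ x, h) = p (fx, fh) (x, h))
    (L : (Fin N → EuclideanSpace ℝ (Fin 3)) → (Fin N → (Fin d → ℝ)) →
      (Fin F → EuclideanSpace ℝ (Fin 3)) → (Fin F → (Fin d → ℝ)) → ℝ)
    (hL : ∀ x h xf hf, L x h xf hf =
      (∫ f : (Fin F → EuclideanSpace ℝ (Fin 3)) × (Fin F → (Fin k → ℝ)),
        q (xf, hf) f • Real.log (p f (x, h))) -
      (∫ f : (Fin F → EuclideanSpace ℝ (Fin 3)) × (Fin F → (Fin k → ℝ)),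
        q (xf, hf) f • Real.log (q (xf, hf) f / φ₀ f))) :
    ∀ (R : EuclideanSpace ℝ (Fin 3) ≃ₗᵢ[ℝ] EuclideanSpace ℝ (Fin 3))
      (x : Fin N → EuclideanSpace ℝ (Fin 3)) (h : Fin N → (Fin d → ℝ))
      (xf : Fin F → EuclideanSpace ℝ (Fin 3)) (hf : Fin F → (Fin d → ℝ)),
      L (⇑R ∘ x) h (⇑R ∘ xf) hf = L x h xf hf := by
  intro R x h xf hf
  let T : ((Fin F → EuclideanSpace ℝ (Fin 3)) × (Fin F → (Fin k → ℝ))) ≃ᵐ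
      ((Fin F → EuclideanSpace ℝ (Fin 3)) × (Fin F → (Fin k → ℝ))) :=
    MeasurableEquiv.prodCongr
      (MeasurableEquiv.piCongrRight (fun _ => R.toHomeomorph.toMeasurableEquiv))
      (MeasurableEquiv.refl _)
  have hT : ∀ f, T f = (⇑R ∘ f.1, f.2) := fun f => rfl
  have hmp : MeasurePreserving T volume volume := by
    have h1 : MeasurePreserving
        (fun (a : Fin F → EuclideanSpace ℝ (Fin 3)) i => R (a i)) volume volume :=
      volume_preserving_pi (fun _ => R.measurePreserving)
    exact h1.prod (MeasurePreserving.id (volume : Measure (Fin F → (Fin k → ℝ))))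
  rw [hL, hL]
  congr 1
  · rw [← hmp.integral_comp T.measurableEmbedding]
    refine integral_congr_ae (Filter.Eventually.of_forall fun f => ?_)
    simp only [hT, hqequiv, hpequiv]
  · rw [← hmp.integral_comp T.measurableEmbedding]
    refine integral_congr_ae (Filter.Eventually.of_forall fun f => ?_)
    simp only [hT, hqequiv, hφ₀inv]
end

section
/- Let N, F, k, T be natural numbers with 2 ≤ T, write E = EuclideanSpace ℝ (Fin 3) and Z = Fin N → E. Suppose given measurable families qm : ℕ → Z → Z → ℝ (the density of z_t given z_0), qp : ℕ → Z → Z → Z → ℝ (the density of z_{t−1} given z_t and z_0), and pθ : ℕ → Z → ((Fin F → E) × (Fin F → (Fin k → ℝ))) → Z → ℝ (the reverse density of z_{t−1} given z_t and condition (fx, fh)) satisfying, for every rotation R and all arguments: qm t (R ∘ z0) (R ∘ z) = qm t z0 z; qp t (R ∘ zt) (R ∘ z0) (R ∘ z) = qp t zt z0 z; and pθ t (R ∘ zt) (R ∘ fx, fh) (R ∘ z) = pθ t zt (fx, fh) z. Define the diffusion loss L (z0, fx, fh) = (∑ t in Finset.Icc 2 T, ∫ qm t z0 zt • (∫ qp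 t zt z0 z • Real.log (qp t zt z0 z / pθ t zt (fx, fh) z) dz) dzt) − ∫ qm 1 z0 z1 • Real.log (pθ 1 z1 (fx, fh) z0) dz1, with all Bochner integrals over Z with respect to Lebesgue (volume) measure. Then for every rotation R, L (R ∘ z0, R ∘ fx, fh) = L (z0, fx, fh). -/
open MeasureTheory

theorem rot_integral_comp {N : ℕ}
    (R : EuclideanSpace ℝ (Fin 3) ≃ₗᵢ[ℝ] EuclideanSpace ℝ (Fin 3))
    (g : (Fin N → EuclideanSpace ℝ (Fin 3)) → ℝ) :
    ∫ z, g z = ∫ z, g (⇑R ∘ z) := by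
  have h : MeasurePreserving
      (fun (z : Fin N → EuclideanSpace ℝ (Fin 3)) => (⇑R ∘ z)) volume volume :=
    volume_preserving_pi (fun _ : Fin N => R.measurePreserving)
  have he : MeasurableEmbedding
      (fun (z : Fin N → EuclideanSpace ℝ (Fin 3)) => (⇑R ∘ z)) :=
    (MeasurableEquiv.piCongrRight
      (fun _ : Fin N => R.toHomeomorph.toMeasurableEquiv)).measurableEmbedding
  exact (h.integral_comp he g).symm

/-- rotation invariance of the structural-prior steered diffusion loss. -/
theorem dsdm_loss_rotation_invariant (N F k T : ℕ) (hT : 2 ≤ T)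
    (qm : ℕ → (Fin N → EuclideanSpace ℝ (Fin 3)) → (Fin N → EuclideanSpace ℝ (Fin 3)) → ℝ)
    (qp : ℕ → (Fin N → EuclideanSpace ℝ (Fin 3)) → (Fin N → EuclideanSpace ℝ (Fin 3)) →
      (Fin N → EuclideanSpace ℝ (Fin 3)) → ℝ)
    (pθ : ℕ → (Fin N → EuclideanSpace ℝ (Fin 3)) →
      ((Fin F → EuclideanSpace ℝ (Fin 3)) × (Fin F → (Fin k → ℝ))) →
      (Fin N → EuclideanSpace ℝ (Fin 3)) → ℝ)
    (hqm : ∀ t, Measurable (fun p : (Fin N → EuclideanSpace ℝ (Fin 3)) ×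
      (Fin N → EuclideanSpace ℝ (Fin 3)) => qm t p.1 p.2))
    (hqp : ∀ t, Measurable (fun p : (Fin N → EuclideanSpace ℝ (Fin 3)) ×
      (Fin N → EuclideanSpace ℝ (Fin 3)) × (Fin N → EuclideanSpace ℝ (Fin 3)) =>
      qp t p.1 p.2.1 p.2.2))
    (hpθ : ∀ t, Measurable (fun p : (Fin N → EuclideanSpace ℝ (Fin 3)) ×
      ((Fin F → EuclideanSpace ℝ (Fin 3)) × (Fin F → (Fin k → ℝ))) ×
      (Fin N → EuclideanSpace ℝ (Fin 3)) => pθ t p.1 p.2.1 p.2.2))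
    (hqminv : ∀ (R : EuclideanSpace ℝ (Fin 3) ≃ₗᵢ[ℝ] EuclideanSpace ℝ (Fin 3)) (t : ℕ)
      (z0 z : Fin N → EuclideanSpace ℝ (Fin 3)), qm t (⇑R ∘ z0) (⇑R ∘ z) = qm t z0 z)
    (hqpinv : ∀ (R : EuclideanSpace ℝ (Fin 3) ≃ₗᵢ[ℝ] EuclideanSpace ℝ (Fin 3)) (t : ℕ)
      (zt z0 z : Fin N → EuclideanSpace ℝ (Fin 3)),
      qp t (⇑R ∘ zt) (⇑R ∘ z0) (⇑R ∘ z) = qp t zt z0 z)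
    (hpθequiv : ∀ (R : EuclideanSpace ℝ (Fin 3) ≃ₗᵢ[ℝ] EuclideanSpace ℝ (Fin 3)) (t : ℕ)
      (zt : Fin N → EuclideanSpace ℝ (Fin 3)) (fx : Fin F → EuclideanSpace ℝ (Fin 3))
      (fh : Fin F → (Fin k → ℝ)) (z : Fin N → EuclideanSpace ℝ (Fin 3)),
      pθ t (⇑R ∘ zt) (⇑R ∘ fx, fh) (⇑R ∘ z) = pθ t zt (fx, fh) z)
    (L : (Fin N → EuclideanSpace ℝ (Fin 3)) → (Fin F → EuclideanSpace ℝ (Fin 3)) →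
      (Fin F → (Fin k → ℝ)) → ℝ)
    (hL : ∀ z0 fx fh, L z0 fx fh =
      (∑ t ∈ Finset.Icc 2 T, ∫ zt : Fin N → EuclideanSpace ℝ (Fin 3),
        qm t z0 zt • (∫ z : Fin N → EuclideanSpace ℝ (Fin 3),
          qp t zt z0 z • Real.log (qp t zt z0 z / pθ t zt (fx, fh) z))) -
      ∫ z1 : Fin N → EuclideanSpace ℝ (Fin 3),
        qm 1 z0 z1 • Real.log (pθ 1 z1 (fx, fh) z0)) :
    ∀ (R : EuclideanSpace ℝ (Fin 3) ≃ₗᵢ[ℝ] EuclideanSpace ℝ (Fin 3))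
      (z0 : Fin N → EuclideanSpace ℝ (Fin 3)) (fx : Fin F → EuclideanSpace ℝ (Fin 3))
      (fh : Fin F → (Fin k → ℝ)),
      L (⇑R ∘ z0) (⇑R ∘ fx) fh = L z0 fx fh := by
  intro R z0 fx fh
  rw [hL, hL]
  congr 1
  · refine Finset.sum_congr rfl fun t _ => ?_
    rw [rot_integral_comp R]
    refine integral_congr_ae (Filter.Eventually.of_forall fun zt => ?_)
    beta_reduce
    rw [hqminv, rot_integral_comp R]
    simp only [hqpinv, hpθequiv]
  · rw [rot_integral_comp R]
    simp only [hqminv, hpθequiv]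
end

section
/- Let d, T be natural numbers with 2 ≤ T. For each t ∈ {1, …, T} let q t : (Fin d → ℝ) → (Fin d → ℝ) → ℝ be measurable, strictly positive, and a probability density in its second argument (∫ q t z w dw = 1 for every z), with respect to Lebesgue measure. Fix z0 : Fin d → ℝ; define the joint forward density Q z = ∏_{t=1}^{T} q t (z_{t−1}) (z_t) on trajectories z : Fin T → (Fin d → ℝ) (with z_0 := z0), marginals m 1 = q 1 z0 and m t b = ∫ m (t−1) a • q t a b da for 2 ≤ t ≤ T, and posteriors post t zt a = q t a zt • m (t−1) a / m t zt for 2 ≤ t ≤ T. Let pT : (Fin d → ℝ) → ℝ and p t : (Fin d → ℝ) → (Fin d → ℝ) → ℝ (1 ≤ t ≤ T) be measurable strictly positive densities, and define the reverse-model marginal p̂ z0 = ∫ pT (z_T) • p 1 (z_1) z0 • ∏_{t=2}^{T} p t (z_t) (z_{t−1}) dz over trajectories. Assume 0 < p̂ z0 < ∞ and that every integrand appearing below is integrable. Then Real.log (p̂ z0) ≥ ∫ m 1 z1 • Real.log (p 1 z1 z0) dz1 + ∫ m T z • Real.log (pT z / m T z) dz + ∑_{t=2}^{T} ∫ m t zt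 • (∫ post t zt a • Real.log (p t zt a / post t zt a) da) dzt. -/
open MeasureTheory

/-- Extend a trajectory `z : Fin T → α` (holding `z_1, …, z_T`) to an index `t : ℕ`,
with `z_0 := z0`. -/
def traj {α : Type*} {T : ℕ} (z0 : α) (z : Fin T → α) (t : ℕ) : α :=
  if h : 1 ≤ t ∧ t ≤ T then z ⟨t - 1, by omega⟩ else z0

/-- Time-`t` marginal density of the forward Markov process started at `z0`:
`m 1 = q 1 z0` and `m t b = ∫ m (t-1) a • q t a b da` for `t ≥ 2`. -/
noncomputable def marg {d : ℕ} (q : ℕ → (Fin d → ℝ) → (Fin d → ℝ) → ℝ)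
    (z0 : Fin d → ℝ) : ℕ → (Fin d → ℝ) → ℝ
  | 0 => fun _ => 0
  | 1 => q 1 z0
  | (t + 2) => fun b => ∫ a, marg q z0 (t + 1) a • q (t + 2) a b

/-- One-step forward posterior density of `z_{t-1}` given `z_t` (and `z_0`):
`post t zt a = q t a zt • m (t-1) a / m t zt`. -/
noncomputable def post {d : ℕ} (q : ℕ → (Fin d → ℝ) → (Fin d → ℝ) → ℝ)
    (z0 : Fin d → ℝ) (t : ℕ) (zt a : Fin d → ℝ) : ℝ :=
  q t a zt • marg q z0 (t - 1) a / marg q z0 t zt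

abbrev A (d:ℕ) := Fin d → ℝ

lemma lint_succ {d n : ℕ} (F : (Fin (n+1) → A d) → ENNReal) (hF : Measurable F) :
    ∫⁻ z, F z = ∫⁻ z : Fin n → A d, ∫⁻ w : A d, F (Fin.snoc (α := fun _ => A d) z w) := by
  have mp := (volume_preserving_piFinSuccAbove (fun _ : Fin (n+1) => A d) (Fin.last n))
  have mp' := mp.symm
  rw [← mp'.lintegral_comp hF, Measure.volume_eq_prod, lintegral_prod_symm]
  · refine lintegral_congr fun z => lintegral_congr fun w => ?_
    congr 1
    simp [MeasurableEquiv.piFinSuccAbove, Fin.insertNthEquiv, Fin.insertNth_last']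
  · exact (hF.comp mp'.measurable).aemeasurable

lemma traj_snoc_le {d n : ℕ} (z0 : A d) (z : Fin n → A d) (w : A d) (t : ℕ) (ht : t ≤ n) :
    traj z0 (Fin.snoc (α := fun _ => A d) z w : Fin (n+1) → A d) t = traj z0 z t := by
  unfold traj
  by_cases h : 1 ≤ t
  · rw [dif_pos ⟨h, by omega⟩, dif_pos ⟨h, ht⟩]
    have h' : t - 1 < n := by omega
    simp only [Fin.snoc, h', dif_pos]
    rfl
  · rw [dif_neg (by omega), dif_neg (by omega)]

lemma traj_snoc_last {d n : ℕ} (z0 : A d) (z : Fin n → A d) (w : A d) :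
    traj z0 (Fin.snoc (α := fun _ => A d) z w : Fin (n+1) → A d) (n+1) = w := by
  unfold traj
  rw [dif_pos ⟨by omega, le_refl _⟩]
  simp [Fin.snoc]

lemma traj_meas {d n : ℕ} (z0 : A d) (t : ℕ) :
    Measurable (fun z : Fin n → A d => traj z0 z t) := by
  unfold traj
  by_cases h : 1 ≤ t ∧ t ≤ n
  · simp only [dif_pos h]; exact measurable_pi_apply _
  · simp only [dif_neg h]; exact measurable_const

noncomputable def Qd {d : ℕ} (q : ℕ → A d → A d → ℝ) (z0 : A d) (n : ℕ) (z : Fin n → A d) : ENNReal :=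
  ∏ t ∈ Finset.Icc 1 n, ENNReal.ofReal (q t (traj z0 z (t-1)) (traj z0 z t))

lemma Qd_snoc {d n : ℕ} (q : ℕ → A d → A d → ℝ) (z0 : A d) (z : Fin n → A d) (w : A d) :
    Qd q z0 (n+1) (Fin.snoc (α := fun _ => A d) z w) =
      Qd q z0 n z * ENNReal.ofReal (q (n+1) (traj z0 z n) w) := by
  unfold Qd
  rw [Finset.prod_Icc_succ_top (by omega), traj_snoc_last, Nat.add_sub_cancel,
    traj_snoc_le _ _ _ _ le_rfl]
  congr 1
  refine Finset.prod_congr rfl fun t ht => ?_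
  rw [Finset.mem_Icc] at ht
  rw [traj_snoc_le _ _ _ _ (by omega), traj_snoc_le _ _ _ _ (by omega)]

lemma Qd_meas {d n T : ℕ} (q : ℕ → A d → A d → ℝ) (z0 : A d)
    (hqmeas : ∀ t, 1 ≤ t → t ≤ T → Measurable (fun pr : A d × A d => q t pr.1 pr.2)) (hn : n ≤ T) :
    Measurable (Qd q z0 n) := by
  unfold Qd
  refine Finset.measurable_prod _ fun t ht => ?_
  rw [Finset.mem_Icc] at ht
  exact ((hqmeas t ht.1 (by omega)).comp ((traj_meas z0 (t-1)).prodMk (traj_meas z0 t))).ennreal_ofReal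

/-- Basic facts about marginals. -/
lemma marg_facts {d T : ℕ} (q : ℕ → A d → A d → ℝ) (z0 : A d)
    (hqmeas : ∀ t, 1 ≤ t → t ≤ T → Measurable (fun pr : A d × A d => q t pr.1 pr.2))
    (hqpos : ∀ t, 1 ≤ t → t ≤ T → ∀ z w, 0 < q t z w)
    (hq1 : ∀ t, 1 ≤ t → t ≤ T → ∀ z, (∫⁻ w, ENNReal.ofReal (q t z w)) = 1)
    (n : ℕ) (h1 : 1 ≤ n) : n ≤ T →
    Measurable (marg q z0 n) ∧ (∀ b, 0 ≤ marg q z0 n b) ∧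
    (∫⁻ b, ENNReal.ofReal (marg q z0 n b)) = 1 ∧ (∀ᵐ b, 0 < marg q z0 n b) ∧
    (2 ≤ n → ∀ᵐ b, ENNReal.ofReal (marg q z0 n b) =
      ∫⁻ a, ENNReal.ofReal (marg q z0 (n-1) a) * ENNReal.ofReal (q n a b)) := by
  induction n, h1 using Nat.le_induction with
  | base =>
    intro hT
    refine ⟨?_, ?_, ?_, ?_, by omega⟩
    · exact (hqmeas 1 le_rfl hT).comp (measurable_const.prodMk measurable_id)
    · exact fun b => (hqpos 1 le_rfl hT _ _).le
    · exact hq1 1 le_rfl hT z0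
    · exact Filter.Eventually.of_forall fun b => (hqpos 1 le_rfl hT _ _)
  | succ n h1 ih =>
    intro hT
    obtain ⟨ihm, ih0, ihi, ihp, -⟩ := ih (by omega)
    have hq := hqmeas (n+1) (by omega) hT
    have hdef : marg q z0 (n+1) = fun b => ∫ a, marg q z0 n a * q (n+1) a b := by
      obtain ⟨k, rfl⟩ : ∃ k, n = k+1 := ⟨n-1, by omega⟩
      simp only [marg, smul_eq_mul]
    have hm2 : Measurable (fun x : A d × A d => marg q z0 n x.2 * q (n+1) x.2 x.1) :=
      (ihm.comp measurable_snd).mul (hq.comp measurable_swap)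
    have hm : Measurable (marg q z0 (n+1)) := by
      rw [hdef]
      exact (hm2.stronglyMeasurable.integral_prod_right (ν := volume)).measurable
    have h0 : ∀ b a, 0 ≤ marg q z0 n a * q (n+1) a b := fun b a =>
      mul_nonneg (ih0 a) (hqpos _ (by omega) hT _ _).le
    have hI : (∫⁻ b, ∫⁻ a, ENNReal.ofReal (marg q z0 n a) * ENNReal.ofReal (q (n+1) a b)) = 1 := by
      rw [lintegral_lintegral_swap]
      · rw [← ihi]
        refine lintegral_congr fun a => ?_
        rw [lintegral_const_mul]
        · rw [hq1 _ (by omega) hT, mul_one]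
        · exact (hq.comp (measurable_const.prodMk measurable_id)).ennreal_ofReal
      · exact ((ihm.comp measurable_snd).ennreal_ofReal.mul
          (hq.comp measurable_swap).ennreal_ofReal).aemeasurable
    have hfin : ∀ᵐ b, (∫⁻ a, ENNReal.ofReal (marg q z0 n a) * ENNReal.ofReal (q (n+1) a b)) < ⊤ := by
      apply ae_lt_top
      · exact ((ihm.comp measurable_snd).ennreal_ofReal.mul
          (hq.comp measurable_swap).ennreal_ofReal).lintegral_prod_right'
      · rw [hI]; simp
    have hint : ∀ᵐ b, Integrable (fun a => marg q z0 n a * q (n+1) a b) := by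
      filter_upwards [hfin] with b hb
      refine ⟨(hm2.comp (measurable_const.prodMk measurable_id)).aestronglyMeasurable, ?_⟩
      rw [hasFiniteIntegral_iff_ofReal (Filter.Eventually.of_forall (h0 b))]
      refine lt_of_eq_of_lt (lintegral_congr fun a => ?_) hb
      rw [ENNReal.ofReal_mul (ih0 _)]
    have hkey : ∀ᵐ b, ENNReal.ofReal (marg q z0 (n+1) b) =
      ∫⁻ a, ENNReal.ofReal (marg q z0 n a) * ENNReal.ofReal (q (n+1) a b) := by
      filter_upwards [hint] with b hb
      rw [hdef]
      dsimp only
      rw [ofReal_integral_eq_lintegral_ofReal hb (Filter.Eventually.of_forall (h0 b))]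
      refine lintegral_congr fun a => ?_
      rw [ENNReal.ofReal_mul (ih0 _)]
    refine ⟨hm, ?_, ?_, ?_, fun _ => hkey⟩
    · intro b; rw [hdef]; exact integral_nonneg (h0 b)
    · rw [lintegral_congr_ae hkey, hI]
    · filter_upwards [hint] with b hb
      rw [hdef]
      dsimp only
      rw [integral_pos_iff_support_of_nonneg (h0 b) hb]
      have : Function.support (fun a => marg q z0 n a * q (n+1) a b) =ᵐ[volume] Set.univ := by
        rw [Filter.eventuallyEq_univ]
        filter_upwards [ihp] with a ha
        exact (mul_pos ha (hqpos _ (by omega) hT _ _)).ne'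
      rw [measure_congr this]
      exact (NeZero.pos _)

lemma Q_last {d T : ℕ} (q : ℕ → A d → A d → ℝ) (z0 : A d)
    (hqmeas : ∀ t, 1 ≤ t → t ≤ T → Measurable (fun pr : A d × A d => q t pr.1 pr.2))
    (hqpos : ∀ t, 1 ≤ t → t ≤ T → ∀ z w, 0 < q t z w)
    (hq1 : ∀ t, 1 ≤ t → t ≤ T → ∀ z, (∫⁻ w, ENNReal.ofReal (q t z w)) = 1)
    (n : ℕ) (h1 : 1 ≤ n) : n ≤ T → ∀ f : A d → ENNReal, Measurable f →
    ∫⁻ z, Qd q z0 n z * f (traj z0 z n) = ∫⁻ b, ENNReal.ofReal (marg q z0 n b) * f b := by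
  induction n, h1 using Nat.le_induction with
  | base =>
    intro hT f hf
    rw [lint_succ (n := 0) (fun z => Qd q z0 1 z * f (traj z0 z 1))
      ((Qd_meas q z0 hqmeas hT).mul (hf.comp (traj_meas z0 1)))]
    simp only [Qd_snoc]
    simp only [traj_snoc_last (n := 0), Nat.zero_add]
    rw [lintegral_unique]
    have hv : (volume : Measure (Fin 0 → A d)) Set.univ = 1 := by
      rw [volume_pi, Measure.pi_univ]; simp
    rw [hv]
    simp [Qd, traj, marg]
  | succ n h1 ih =>
    intro hT f hf
    have hq := hqmeas (n+1) (by omega) hT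
    have hM := marg_facts q z0 hqmeas hqpos hq1
    rw [lint_succ (fun z => Qd q z0 (n+1) z * f (traj z0 z (n+1)))
      ((Qd_meas q z0 hqmeas hT).mul (hf.comp (traj_meas z0 _)))]
    simp only [Qd_snoc, traj_snoc_last, mul_assoc]
    have hmm : Measurable (fun x : A d × A d => ENNReal.ofReal (q (n+1) x.1 x.2) * f x.2) :=
      hq.ennreal_ofReal.mul (hf.comp measurable_snd)
    have e1 : ∀ z : Fin n → A d, (∫⁻ w, Qd q z0 n z * (ENNReal.ofReal (q (n+1) (traj z0 z n) w) * f w)) =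
        Qd q z0 n z * (fun a => ∫⁻ w, ENNReal.ofReal (q (n+1) a w) * f w) (traj z0 z n) := by
      intro z
      rw [lintegral_const_mul]
      exact hmm.comp (measurable_const.prodMk measurable_id)
    rw [lintegral_congr e1, ih (by omega) _ hmm.lintegral_prod_right']
    have e2 : ∀ a, ENNReal.ofReal (marg q z0 n a) * ∫⁻ w, ENNReal.ofReal (q (n+1) a w) * f w =
        ∫⁻ w, ENNReal.ofReal (marg q z0 n a) * (ENNReal.ofReal (q (n+1) a w) * f w) := by
      intro a
      rw [lintegral_const_mul]
      exact hmm.comp (measurable_const.prodMk measurable_id)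
    dsimp only
    rw [lintegral_congr e2, lintegral_lintegral_swap]
    · refine lintegral_congr_ae ?_
      filter_upwards [(hM (n+1) (by omega) hT).2.2.2.2 (by omega)] with b hb
      rw [hb, Nat.add_sub_cancel, ← lintegral_mul_const]
      · simp only [mul_assoc]
      · exact (hM n h1 (by omega)).1.ennreal_ofReal.mul
          (hq.comp (measurable_id.prodMk measurable_const)).ennreal_ofReal
    · exact (((hM n h1 (by omega)).1.comp measurable_fst).ennreal_ofReal.mul hmm).aemeasurable

lemma Q_drop {d T : ℕ} (q : ℕ → A d → A d → ℝ) (z0 : A d)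
    (hqmeas : ∀ t, 1 ≤ t → t ≤ T → Measurable (fun pr : A d × A d => q t pr.1 pr.2))
    (hq1 : ∀ t, 1 ≤ t → t ≤ T → ∀ z, (∫⁻ w, ENNReal.ofReal (q t z w)) = 1)
    (s t : ℕ) (hst : s ≤ t) (F : A d × A d → ENNReal) (hF : Measurable F)
    (n : ℕ) (h1 : t ≤ n) : n ≤ T → 
    ∫⁻ z, Qd q z0 n z * F (traj z0 z s, traj z0 z t) =
    ∫⁻ z, Qd q z0 t z * F (traj z0 z s, traj z0 z t) := by
  induction n, h1 using Nat.le_induction with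
  | base => intro _; rfl
  | succ n h1 ih =>
    intro hT
    have hq := hqmeas (n+1) (by omega) hT
    rw [← ih (by omega), lint_succ (fun z => Qd q z0 (n+1) z * F (traj z0 z s, traj z0 z t)) ((Qd_meas q z0 hqmeas hT).mul
      (hF.comp ((traj_meas z0 _).prodMk (traj_meas z0 _))))]
    refine lintegral_congr fun z => ?_
    simp only [Qd_snoc, traj_snoc_le _ _ _ _ h1, traj_snoc_le _ _ _ _ (hst.trans h1)]
    have : ∀ w, Qd q z0 n z * ENNReal.ofReal (q (n+1) (traj z0 z n) w) * F (traj z0 z s, traj z0 z t)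
      = Qd q z0 n z * F (traj z0 z s, traj z0 z t) * ENNReal.ofReal (q (n+1) (traj z0 z n) w) :=
      fun w => by ring
    rw [lintegral_congr this, lintegral_const_mul, hq1 _ (by omega) hT, mul_one]
    exact (hq.comp (measurable_const.prodMk measurable_id)).ennreal_ofReal

lemma Q_pair {d T : ℕ} (q : ℕ → A d → A d → ℝ) (z0 : A d)
    (hqmeas : ∀ t, 1 ≤ t → t ≤ T → Measurable (fun pr : A d × A d => q t pr.1 pr.2))
    (hqpos : ∀ t, 1 ≤ t → t ≤ T → ∀ z w, 0 < q t z w)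
    (hq1 : ∀ t, 1 ≤ t → t ≤ T → ∀ z, (∫⁻ w, ENNReal.ofReal (q t z w)) = 1)
    (n : ℕ) (h1 : 1 ≤ n) (hT : n + 1 ≤ T) (F : A d × A d → ENNReal) (hF : Measurable F) :
    ∫⁻ z, Qd q z0 T z * F (traj z0 z n, traj z0 z (n+1)) =
      ∫⁻ x : A d × A d, ENNReal.ofReal (marg q z0 n x.1 * q (n+1) x.1 x.2) * F x := by
  have hq := hqmeas (n+1) (by omega) hT
  have hM := marg_facts q z0 hqmeas hqpos hq1 n h1 (by omega)
  rw [Q_drop q z0 hqmeas hq1 n (n+1) (by omega) F hF T hT le_rfl]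
  rw [lint_succ (fun z => Qd q z0 (n+1) z * F (traj z0 z n, traj z0 z (n+1))) ((Qd_meas q z0 hqmeas hT).mul
      (hF.comp ((traj_meas z0 _).prodMk (traj_meas z0 _))))]
  have hmm : Measurable (fun x : A d × A d => ENNReal.ofReal (q (n+1) x.1 x.2) * F x) :=
      hq.ennreal_ofReal.mul hF
  simp only [Qd_snoc, traj_snoc_last, mul_assoc, traj_snoc_le _ _ _ _ (le_refl n)]
  have e1 : ∀ z : Fin n → A d, (∫⁻ w, Qd q z0 n z * (ENNReal.ofReal (q (n+1) (traj z0 z n) w) * F (traj z0 z n, w))) =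
        Qd q z0 n z * (fun a => ∫⁻ w, ENNReal.ofReal (q (n+1) a w) * F (a, w)) (traj z0 z n) := by
    intro z
    rw [lintegral_const_mul]
    exact hmm.comp (measurable_const.prodMk measurable_id)
  rw [lintegral_congr e1, Q_last q z0 hqmeas hqpos hq1 n h1 (by omega) _ hmm.lintegral_prod_right']
  rw [Measure.volume_eq_prod, lintegral_prod]
  · refine lintegral_congr fun a => ?_
    dsimp only
    rw [← lintegral_const_mul]
    · refine lintegral_congr fun w => ?_
      rw [ENNReal.ofReal_mul (hM.2.1 _), mul_assoc]
    · exact hmm.comp (measurable_const.prodMk measurable_id)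
  · exact (((hM.1.comp measurable_fst).mul hq).ennreal_ofReal.mul hF).aemeasurable

lemma kl_aux {P R : ℝ} (hP : 0 < P) (hR : 0 ≤ R) :
    |R * Real.log (P / R)| ≤ 2 * P - R * Real.log (P / R) := by
  have h : R * Real.log (P / R) ≤ P := by
    rcases hR.eq_or_lt with h | h
    · rw [← h]; simp [hP.le]
    · have h2 := Real.log_le_sub_one_of_pos (div_pos hP h)
      have h3 := mul_le_mul_of_nonneg_left h2 hR
      have h4 : R * (P / R - 1) = P - R := by field_simp
      linarith
  rw [abs_le]
  constructor <;> linarith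

lemma kl_int {d : ℕ} (m : A d → ℝ) (P R : A d → A d → ℝ)
    (hm : Measurable m) (hm0 : ∀ b, 0 ≤ m b) (hmi : Integrable m)
    (hPm : Measurable (fun x : A d × A d => P x.1 x.2))
    (hRm : Measurable (fun x : A d × A d => R x.1 x.2))
    (hP : ∀ b a, 0 < P b a) (hR : ∀ b a, 0 ≤ R b a) (hP1 : ∀ b, ∫ a, P b a = 1)
    (hin : ∀ b, Integrable (fun a => R b a * Real.log (P b a / R b a)))
    (hout : Integrable (fun b => m b * ∫ a, R b a * Real.log (P b a / R b a))) :
    Integrable (fun x : A d × A d => m x.1 * (R x.1 x.2 * Real.log (P x.1 x.2 / R x.1 x.2))) ∧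
    ∫ x : A d × A d, m x.1 * (R x.1 x.2 * Real.log (P x.1 x.2 / R x.1 x.2)) =
      ∫ b, m b * ∫ a, R b a * Real.log (P b a / R b a) := by
  have hmeas : Measurable (fun x : A d × A d => m x.1 * (R x.1 x.2 * Real.log (P x.1 x.2 / R x.1 x.2))) :=
    (hm.comp measurable_fst).mul (hRm.mul (hPm.div hRm).log)
  have hPi : ∀ b, Integrable (P b) := fun b =>
    Integrable.of_integral_ne_zero (by rw [hP1 b]; exact one_ne_zero)
  have hI : Integrable (fun x : A d × A d => m x.1 * (R x.1 x.2 * Real.log (P x.1 x.2 / R x.1 x.2))) := by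
    rw [Measure.volume_eq_prod, integrable_prod_iff hmeas.aestronglyMeasurable]
    refine ⟨Filter.Eventually.of_forall fun b => (hin b).const_mul (m b), ?_⟩
    refine Integrable.mono' ((hmi.const_mul 2).sub hout)
      hmeas.stronglyMeasurable.norm.integral_prod_right.aestronglyMeasurable ?_
    refine Filter.Eventually.of_forall fun b => ?_
    rw [Real.norm_of_nonneg (integral_nonneg fun a => norm_nonneg _)]
    have : ∫ a, ‖m b * (R b a * Real.log (P b a / R b a))‖ ≤
        ∫ a, m b * (2 * P b a - R b a * Real.log (P b a / R b a)) := by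
      refine integral_mono ((hin b).const_mul _).norm
        ((((hPi b).const_mul 2).sub (hin b)).const_mul _) fun a => ?_
      dsimp only
      rw [norm_mul, Real.norm_of_nonneg (hm0 b), Real.norm_eq_abs]
      exact mul_le_mul_of_nonneg_left (kl_aux (hP b a) (hR b a)) (hm0 b)
    refine this.trans (le_of_eq ?_)
    rw [integral_const_mul, integral_sub ((hPi b).const_mul 2) (hin b), integral_const_mul, hP1]
    simp only [Pi.sub_apply]
    ring
  refine ⟨hI, ?_⟩
  rw [Measure.volume_eq_prod] at hI ⊢
  rw [integral_prod _ hI]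
  simp only [integral_const_mul]

lemma telesc (f : ℕ → ℝ) (T : ℕ) (hT : 1 ≤ T) :
    ∑ t ∈ Finset.Icc 2 T, (f t - f (t-1)) = f T - f 1 := by
  induction T, hT using Nat.le_induction with
  | base => simp
  | succ n hn ih => rw [Finset.sum_Icc_succ_top (by omega), ih, Nat.add_sub_cancel]; ring

/-- integrals of functions of one coordinate / pair under the trajectory measure -/
lemma transfer {Ω X : Type*} [MeasurableSpace Ω] [MeasurableSpace X] (μ : Measure Ω) (ν : Measure X)
    (π : Ω → X) (hπ : Measurable π) (ρ : X → ℝ) (hρ : Measurable ρ) (hρ0 : ∀ x, 0 ≤ ρ x)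
    (h : ∀ f : X → ENNReal, Measurable f → ∫⁻ z, f (π z) ∂μ = ∫⁻ x, ENNReal.ofReal (ρ x) * f x ∂ν)
    (φ : X → ℝ) (hφ : Measurable φ) (hi : Integrable (fun x => ρ x * φ x) ν) :
    Integrable (fun z => φ (π z)) μ ∧ ∫ z, φ (π z) ∂μ = ∫ x, ρ x * φ x ∂ν := by
  have e : μ.map π = ν.withDensity (fun x => ENNReal.ofReal (ρ x)) := by
    refine Measure.ext_of_lintegral _ fun f hf => ?_
    rw [lintegral_map hf hπ, h f hf, lintegral_withDensity_eq_lintegral_mul _ hρ.ennreal_ofReal hf]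
    rfl
  have hfin : ∀ᵐ x ∂ν, ENNReal.ofReal (ρ x) < ⊤ := Filter.Eventually.of_forall fun x => by simp
  have hi' : Integrable φ (μ.map π) := by
    rw [e, integrable_withDensity_iff_integrable_smul' hρ.ennreal_ofReal hfin]
    simpa only [ENNReal.toReal_ofReal (hρ0 _), smul_eq_mul] using hi
  refine ⟨hi'.comp_measurable hπ, ?_⟩
  rw [← integral_map hπ.aemeasurable hφ.aestronglyMeasurable, e,
    integral_withDensity_eq_integral_toReal_smul hρ.ennreal_ofReal hfin]
  simp only [ENNReal.toReal_ofReal (hρ0 _), smul_eq_mul]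

/-- the variational lower bound on the log-likelihood of a diffusion model. -/
theorem diffusion_vlb (d T : ℕ) (hT : 2 ≤ T)
    (q : ℕ → (Fin d → ℝ) → (Fin d → ℝ) → ℝ)
    (hqmeas : ∀ t, 1 ≤ t → t ≤ T →
      Measurable (fun pr : (Fin d → ℝ) × (Fin d → ℝ) => q t pr.1 pr.2))
    (hqpos : ∀ t, 1 ≤ t → t ≤ T → ∀ z w, 0 < q t z w)
    (hqdens : ∀ t, 1 ≤ t → t ≤ T → ∀ z, (∫ w, q t z w) = 1)
    (z0 : Fin d → ℝ)
    (pT : (Fin d → ℝ) → ℝ) (p : ℕ → (Fin d → ℝ) → (Fin d → ℝ) → ℝ)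
    (hpTmeas : Measurable pT) (hpTpos : ∀ z, 0 < pT z) (hpTdens : (∫ z, pT z) = 1)
    (hpmeas : ∀ t, 1 ≤ t → t ≤ T →
      Measurable (fun pr : (Fin d → ℝ) × (Fin d → ℝ) => p t pr.1 pr.2))
    (hppos : ∀ t, 1 ≤ t → t ≤ T → ∀ z w, 0 < p t z w)
    (hpdens : ∀ t, 1 ≤ t → t ≤ T → ∀ z, (∫ w, p t z w) = 1)
    (phat : ℝ)
    (hphat : phat = ∫ z : Fin T → (Fin d → ℝ),
      pT (traj z0 z T) • p 1 (traj z0 z 1) z0 •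
        ∏ t ∈ Finset.Icc 2 T, p t (traj z0 z t) (traj z0 z (t - 1)))
    (hphat_pos : 0 < phat)
    (hint_traj : Integrable (fun z : Fin T → (Fin d → ℝ) =>
      pT (traj z0 z T) • p 1 (traj z0 z 1) z0 •
        ∏ t ∈ Finset.Icc 2 T, p t (traj z0 z t) (traj z0 z (t - 1))))
    (hint_rec : Integrable (fun z1 => marg q z0 1 z1 • Real.log (p 1 z1 z0)))
    (hint_prior : Integrable (fun z => marg q z0 T z • Real.log (pT z / marg q z0 T z)))
    (hint_kl_inner : ∀ t ∈ Finset.Icc 2 T, ∀ zt, Integrable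
      (fun a => post q z0 t zt a • Real.log (p t zt a / post q z0 t zt a)))
    (hint_kl_outer : ∀ t ∈ Finset.Icc 2 T, Integrable (fun zt => marg q z0 t zt •
      ∫ a, post q z0 t zt a • Real.log (p t zt a / post q z0 t zt a))) :
    Real.log phat ≥
      (∫ z1, marg q z0 1 z1 • Real.log (p 1 z1 z0)) +
      (∫ z, marg q z0 T z • Real.log (pT z / marg q z0 T z)) +
      ∑ t ∈ Finset.Icc 2 T, ∫ zt, marg q z0 t zt •
        (∫ a, post q z0 t zt a • Real.log (p t zt a / post q z0 t zt a)) := by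
  simp only [smul_eq_mul] at *
  have hq1 : ∀ t, 1 ≤ t → t ≤ T → ∀ z, (∫⁻ w, ENNReal.ofReal (q t z w)) = 1 := by
    intro t h1 h2 z
    have hi : Integrable (q t z) :=
      Integrable.of_integral_ne_zero (by rw [hqdens t h1 h2 z]; exact one_ne_zero)
    rw [← ofReal_integral_eq_lintegral_ofReal hi
      (Filter.Eventually.of_forall fun w => (hqpos t h1 h2 z w).le), hqdens t h1 h2 z]
    simp
  have hM := marg_facts q z0 hqmeas hqpos hq1
  have hQm := Qd_meas q z0 hqmeas (le_refl T)
  set μ : Measure (Fin T → A d) := volume.withDensity (Qd q z0 T) with hμ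
  have hμl : ∀ f : (Fin T → A d) → ENNReal, Measurable f →
      ∫⁻ z, f z ∂μ = ∫⁻ z, Qd q z0 T z * f z := by
    intro f hf
    rw [hμ, lintegral_withDensity_eq_lintegral_mul _ hQm hf]; rfl
  have hμ1 : μ Set.univ = 1 := by
    have := Q_last q z0 hqmeas hqpos hq1 T (by omega) le_rfl (fun _ => 1) measurable_const
    simp only [mul_one] at this
    rw [hμ, withDensity_apply _ MeasurableSet.univ, Measure.restrict_univ, this]
    exact (hM T (by omega) le_rfl).2.2.1
  have hprob : IsProbabilityMeasure μ := ⟨hμ1⟩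
  -- coordinate positivity
  have hpos : ∀ᵐ z ∂μ, ∀ t ∈ Finset.Icc 1 T, 0 < marg q z0 t (traj z0 z t) := by
    rw [Filter.eventually_all_finset]
    intro t ht
    rw [Finset.mem_Icc] at ht
    refine (withDensity_absolutelyContinuous _ _).ae_le ?_
    have hqm : Measure.QuasiMeasurePreserving
        (Function.eval (⟨t-1, by omega⟩ : Fin T) : (Fin T → A d) → A d) volume volume :=
      Measure.quasiMeasurePreserving_eval (μ := fun _ : Fin T => (volume : Measure (A d))) _
    filter_upwards [hqm.ae (hM t ht.1 ht.2).2.2.2.1] with z hz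
    simpa [traj, ht.1, ht.2] using hz
  -- term 1
  have t1 := transfer μ volume (fun z => traj z0 z 1) (traj_meas z0 1) (marg q z0 1)
    (hM 1 le_rfl (by omega)).1 (hM 1 le_rfl (by omega)).2.1
    (fun f hf => by
      rw [hμl (fun z => f (traj z0 z 1)) (hf.comp (traj_meas z0 1)),
        ← Q_last q z0 hqmeas hqpos hq1 1 le_rfl (by omega) f hf]
      exact Q_drop q z0 hqmeas hq1 1 1 le_rfl (fun x => f x.2) (hf.comp measurable_snd) T
        (by omega) le_rfl)
    (fun z1 => Real.log (p 1 z1 z0))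
    ((hpmeas 1 le_rfl (by omega)).comp (measurable_id.prodMk measurable_const)).log hint_rec
  have t2 := transfer μ volume (fun z => traj z0 z T) (traj_meas z0 T) (marg q z0 T)
    (hM T (by omega) le_rfl).1 (hM T (by omega) le_rfl).2.1
    (fun f hf => by
      rw [hμl (fun z => f (traj z0 z T)) (hf.comp (traj_meas z0 T)),
        ← Q_last q z0 hqmeas hqpos hq1 T (by omega) le_rfl f hf])
    (fun z => Real.log (pT z / marg q z0 T z))
    (hpTmeas.div (hM T (by omega) le_rfl).1).log hint_prior
  have t3 : ∀ t ∈ Finset.Icc 2 T,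
      Integrable (fun z => Real.log (p t (traj z0 z t) (traj z0 z (t-1)) /
        post q z0 t (traj z0 z t) (traj z0 z (t-1)))) μ ∧
      ∫ z, Real.log (p t (traj z0 z t) (traj z0 z (t-1)) /
        post q z0 t (traj z0 z t) (traj z0 z (t-1))) ∂μ =
      ∫ zt, marg q z0 t zt *
        (∫ a, post q z0 t zt a * Real.log (p t zt a / post q z0 t zt a)) := by
    intro t ht
    have hin := hint_kl_inner t ht
    have hout := hint_kl_outer t ht
    rw [Finset.mem_Icc] at ht
    obtain ⟨n, rfl⟩ : ∃ n, t = n + 1 := ⟨t - 1, by omega⟩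
    have hn1 : 1 ≤ n := by omega
    have M0 := hM n hn1 (by omega)
    have M1 := hM (n+1) (by omega) ht.2
    have hq := hqmeas (n+1) (by omega) ht.2
    have hp := hpmeas (n+1) (by omega) ht.2
    have hRm : Measurable (fun x : A d × A d => post q z0 (n+1) x.1 x.2) := by
      simp only [post, smul_eq_mul, Nat.add_sub_cancel]
      exact ((hq.comp measurable_swap).mul (M0.1.comp measurable_snd)).div
        (M1.1.comp measurable_fst)
    have hR0 : ∀ b a, 0 ≤ post q z0 (n+1) b a := by
      intro b a
      simp only [post, smul_eq_mul, Nat.add_sub_cancel]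
      exact div_nonneg (mul_nonneg (hqpos _ (by omega) ht.2 _ _).le (M0.2.1 _)) (M1.2.1 _)
    have hmi : Integrable (marg q z0 (n+1)) := by
      refine ⟨M1.1.aestronglyMeasurable, ?_⟩
      rw [hasFiniteIntegral_iff_ofReal (Filter.Eventually.of_forall M1.2.1), M1.2.2.1]
      simp
    obtain ⟨k1, k2⟩ := kl_int (marg q z0 (n+1)) (p (n+1)) (post q z0 (n+1)) M1.1 M1.2.1 hmi hp hRm
      (hppos _ (by omega) ht.2) hR0 (hpdens _ (by omega) ht.2) hin hout
    rw [← k2]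
    have hswap : MeasurePreserving (Prod.swap : A d × A d → A d × A d) volume volume :=
      Measure.measurePreserving_swap
    have hae : (fun x : A d × A d => (marg q z0 n x.1 * q (n+1) x.1 x.2) *
          Real.log (p (n+1) x.2 x.1 / post q z0 (n+1) x.2 x.1)) =ᵐ[volume]
        (fun x : A d × A d => marg q z0 (n+1) x.1 * (post q z0 (n+1) x.1 x.2 *
          Real.log (p (n+1) x.1 x.2 / post q z0 (n+1) x.1 x.2))) ∘ Prod.swap := by
      have hs : Measure.QuasiMeasurePreserving (Prod.snd : A d × A d → A d) volume volume :=
        Measure.quasiMeasurePreserving_snd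
      filter_upwards [hs.ae M1.2.2.2.1] with x hx
      have : marg q z0 n x.1 * q (n+1) x.1 x.2 =
          marg q z0 (n+1) x.2 * post q z0 (n+1) x.2 x.1 := by
        simp only [post, smul_eq_mul, Nat.add_sub_cancel]
        field_simp
      simp only [Function.comp, Prod.fst_swap, Prod.snd_swap]
      rw [this, mul_assoc]
    have r := transfer μ volume (fun z => (traj z0 z n, traj z0 z (n+1)))
      ((traj_meas z0 n).prodMk (traj_meas z0 (n+1)))
      (fun x : A d × A d => marg q z0 n x.1 * q (n+1) x.1 x.2)
      ((M0.1.comp measurable_fst).mul hq)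
      (fun x => mul_nonneg (M0.2.1 _) (hqpos _ (by omega) ht.2 _ _).le)
      (fun f hf => by
        rw [hμl (fun z => f (traj z0 z n, traj z0 z (n+1))) (hf.comp ((traj_meas z0 n).prodMk (traj_meas z0 (n+1))))]
        exact Q_pair q z0 hqmeas hqpos hq1 n hn1 ht.2 f hf)
      (fun x => Real.log (p (n+1) x.2 x.1 / post q z0 (n+1) x.2 x.1))
      ((hp.comp measurable_swap).div (hRm.comp measurable_swap)).log
      ((hswap.integrable_comp k1.aestronglyMeasurable |>.2 k1).congr hae.symm)
    refine ⟨r.1, r.2.trans ?_⟩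
    rw [integral_congr_ae hae]
    exact hswap.integral_comp MeasurableEquiv.prodComm.measurableEmbedding
      (fun x : A d × A d => marg q z0 (n+1) x.1 * (post q z0 (n+1) x.1 x.2 *
          Real.log (p (n+1) x.1 x.2 / post q z0 (n+1) x.1 x.2)))
  -- the whole log-ratio
  have hSi := integrable_finsetSum _ (fun t ht => (t3 t ht).1)
  have hL := (t1.1.add t2.1).add hSi
  have hLint : ∫ z, (Real.log (p 1 (traj z0 z 1) z0) +
      Real.log (pT (traj z0 z T) / marg q z0 T (traj z0 z T)) +
      ∑ t ∈ Finset.Icc 2 T, Real.log (p t (traj z0 z t) (traj z0 z (t-1)) /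
        post q z0 t (traj z0 z t) (traj z0 z (t-1)))) ∂μ =
      (∫ z1, marg q z0 1 z1 * Real.log (p 1 z1 z0)) +
      (∫ z, marg q z0 T z * Real.log (pT z / marg q z0 T z)) +
      ∑ t ∈ Finset.Icc 2 T, ∫ zt, marg q z0 t zt *
        (∫ a, post q z0 t zt a * Real.log (p t zt a / post q z0 t zt a)) := by
    have e12 := integral_add t1.1 t2.1
    have e123 := integral_add (t1.1.add t2.1) hSi
    simp only [Pi.add_apply] at e123
    rw [e123, e12,
      integral_finsetSum _ (fun t ht => (t3 t ht).1), t1.2, t2.2,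
      Finset.sum_congr rfl (fun t ht => (t3 t ht).2)]
  rw [ge_iff_le, ← hLint]
  set P : (Fin T → A d) → ℝ := fun z => pT (traj z0 z T) * (p 1 (traj z0 z 1) z0 *
        ∏ t ∈ Finset.Icc 2 T, p t (traj z0 z t) (traj z0 z (t - 1))) with hPdef
  have hPprod : ∀ z : Fin T → A d,
      0 < ∏ t ∈ Finset.Icc 2 T, p t (traj z0 z t) (traj z0 z (t - 1)) := fun z =>
    Finset.prod_pos fun t ht => by
      rw [Finset.mem_Icc] at ht; exact hppos t (by omega) ht.2 _ _
  have hp1 : ∀ z, 0 < p 1 z z0 := fun z => hppos 1 le_rfl (by omega) _ _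
  have hPpos : ∀ z, 0 < P z := fun z =>
    mul_pos (hpTpos _) (mul_pos (hp1 _) (hPprod z))
  have hQr : ∀ z, (Qd q z0 T z).toReal =
      ∏ t ∈ Finset.Icc 1 T, q t (traj z0 z (t-1)) (traj z0 z t) := by
    intro z
    rw [Qd, ENNReal.toReal_prod]
    refine Finset.prod_congr rfl fun t ht => ?_
    rw [Finset.mem_Icc] at ht
    exact ENNReal.toReal_ofReal (hqpos t ht.1 ht.2 _ _).le
  have hQpos : ∀ z, 0 < (Qd q z0 T z).toReal := fun z => by
    rw [hQr]
    exact Finset.prod_pos fun t ht => by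
      rw [Finset.mem_Icc] at ht; exact hqpos t ht.1 ht.2 _ _
  have hQfin : ∀ᵐ z, Qd q z0 T z < ⊤ := Filter.Eventually.of_forall fun z =>
    (ENNReal.toReal_pos_iff.1 (hQpos z)).2
  have hcancel : ∀ z, (Qd q z0 T z).toReal • (P z / (Qd q z0 T z).toReal) = P z := fun z => by
    rw [smul_eq_mul, mul_div_cancel₀ _ (hQpos z).ne']
  have hPQi : Integrable (fun z => P z / (Qd q z0 T z).toReal) μ := by
    rw [hμ, integrable_withDensity_iff_integrable_smul' hQm hQfin]
    simpa only [hcancel] using hint_traj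
  have hPQ : ∫ z, P z / (Qd q z0 T z).toReal ∂μ = phat := by
    rw [hμ, integral_withDensity_eq_integral_toReal_smul hQm hQfin, hphat]
    simp only [hcancel]
  have hle : ∀ᵐ z ∂μ, (Real.log (p 1 (traj z0 z 1) z0) +
      Real.log (pT (traj z0 z T) / marg q z0 T (traj z0 z T)) +
      ∑ t ∈ Finset.Icc 2 T, Real.log (p t (traj z0 z t) (traj z0 z (t-1)) /
        post q z0 t (traj z0 z t) (traj z0 z (t-1)))) ≤
      (P z / (Qd q z0 T z).toReal) / phat + (Real.log phat - 1) := by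
    filter_upwards [hpos] with z hz
    have hmT := hz T (Finset.mem_Icc.2 ⟨by omega, le_rfl⟩)
    have hs : ∑ t ∈ Finset.Icc 2 T, Real.log (p t (traj z0 z t) (traj z0 z (t-1)) /
        post q z0 t (traj z0 z t) (traj z0 z (t-1))) =
        ∑ t ∈ Finset.Icc 2 T, (Real.log (p t (traj z0 z t) (traj z0 z (t-1))) -
          Real.log (q t (traj z0 z (t-1)) (traj z0 z t)) +
          ((fun t => Real.log (marg q z0 t (traj z0 z t))) t -
           (fun t => Real.log (marg q z0 t (traj z0 z t))) (t-1))) := by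
      refine Finset.sum_congr rfl fun t ht => ?_
      rw [Finset.mem_Icc] at ht
      have a1 := hz t (Finset.mem_Icc.2 ⟨by omega, ht.2⟩)
      have a2 := hz (t-1) (Finset.mem_Icc.2 ⟨by omega, by omega⟩)
      have a3 := hqpos t (by omega) ht.2 (traj z0 z (t-1)) (traj z0 z t)
      have a4 := hppos t (by omega) ht.2 (traj z0 z t) (traj z0 z (t-1))
      simp only [post, smul_eq_mul]
      rw [Real.log_div a4.ne' (by positivity), Real.log_div (by positivity) a1.ne',
        Real.log_mul a3.ne' a2.ne']
      ring
    rw [hs, Finset.sum_add_distrib, Finset.sum_sub_distrib, telesc _ T (by omega),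
      Real.log_div (hpTpos _).ne' hmT.ne']
    have hlp : Real.log (P z / (Qd q z0 T z).toReal) = Real.log (pT (traj z0 z T)) +
        (Real.log (p 1 (traj z0 z 1) z0) +
          ∑ t ∈ Finset.Icc 2 T, Real.log (p t (traj z0 z t) (traj z0 z (t-1)))) -
        (Real.log (q 1 z0 (traj z0 z 1)) +
          ∑ t ∈ Finset.Icc 2 T, Real.log (q t (traj z0 z (t-1)) (traj z0 z t))) := by
      rw [Real.log_div (hPpos z).ne' (hQpos z).ne', hPdef]
      dsimp only
      rw [Real.log_mul (hpTpos _).ne' (mul_pos (hp1 _) (hPprod z)).ne',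
        Real.log_mul (hp1 _).ne' (hPprod z).ne', hQr z, Real.log_prod, Real.log_prod]
      · rw [← Finset.add_sum_Ioc_eq_sum_Icc (show 1 ≤ T by omega)]
        have e0 : traj z0 z (1 - 1) = z0 := by simp [traj]
        rw [e0]
        rfl
      · intro t ht
        rw [Finset.mem_Icc] at ht
        exact (hqpos t ht.1 ht.2 _ _).ne'
      · intro t ht
        rw [Finset.mem_Icc] at ht
        exact (hppos t (by omega) ht.2 _ _).ne'
    have hx : 0 < P z / (Qd q z0 T z).toReal := div_pos (hPpos z) (hQpos z)
    have h5 := Real.log_le_sub_one_of_pos (div_pos hx hphat_pos)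
    rw [Real.log_div hx.ne' hphat_pos.ne', hlp] at h5
    have em : marg q z0 1 (traj z0 z 1) = q 1 z0 (traj z0 z 1) := rfl
    simp only [em]
    linarith
  refine (integral_mono_ae hL ((hPQi.div_const phat).add (integrable_const _)) hle).trans ?_
  simp only [Pi.add_apply]
  rw [integral_add (hPQi.div_const phat) (integrable_const _), integral_div, hPQ,
    div_self hphat_pos.ne']
  simp
end

section
/- Let N, F, k, T be natural numbers with 1 ≤ T, write E = EuclideanSpace ℝ (Fin 3) and Z = Fin N → E. Let π : Z → ℝ≥0∞ be measurable with π (R ∘ z) = π z for every rotation R and z : Z, and for each t ∈ {1, …, T} let p t : Z → ((Fin F → E) × (Fin F → (Fin k → ℝ))) → Z → ℝ≥0∞ be measurable with p t (R ∘ zt) (R ∘ fx, fh) (R ∘ z) = p t zt (fx, fh) z for every rotation R and all arguments. Define m (z0, fx, fh) = ∫⁻ π (z_T) * ∏_{t=1}^{T} p t (z_t) (fx, fh) (z_{t−1}) dz, the lower integral taken over trajectories z : Fin T → Z with respect to Lebesgue (volume) measure, with z_0 := z0. Then for every rotation R, m (R ∘ z0, R ∘ fx, fh) = m (z0, fx,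 fh). -/
open MeasureTheory ENNReal

/-- an invariant prior density combined with rotation-equivariant reverse
transition densities yields a marginal density invariant under simultaneous rotation
of the sample and the condition. -/
theorem reverse_marginal_rotation_invariant (N F k T : ℕ) (hT : 1 ≤ T)
    (π : (Fin N → EuclideanSpace ℝ (Fin 3)) → ℝ≥0∞)
    (hπmeas : Measurable π)
    (hπinv : ∀ (R : EuclideanSpace ℝ (Fin 3) ≃ₗᵢ[ℝ] EuclideanSpace ℝ (Fin 3))
      (z : Fin N → EuclideanSpace ℝ (Fin 3)), π (⇑R ∘ z) = π z)
    (p : ℕ → (Fin N → EuclideanSpace ℝ (Fin 3)) →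
      ((Fin F → EuclideanSpace ℝ (Fin 3)) × (Fin F → (Fin k → ℝ))) →
      (Fin N → EuclideanSpace ℝ (Fin 3)) → ℝ≥0∞)
    (hpmeas : ∀ t, 1 ≤ t → t ≤ T → Measurable
      (fun pr : (Fin N → EuclideanSpace ℝ (Fin 3)) ×
        ((Fin F → EuclideanSpace ℝ (Fin 3)) × (Fin F → (Fin k → ℝ))) ×
        (Fin N → EuclideanSpace ℝ (Fin 3)) => p t pr.1 pr.2.1 pr.2.2))
    (hpequiv : ∀ (R : EuclideanSpace ℝ (Fin 3) ≃ₗᵢ[ℝ] EuclideanSpace ℝ (Fin 3))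
      (t : ℕ) (zt : Fin N → EuclideanSpace ℝ (Fin 3))
      (fx : Fin F → EuclideanSpace ℝ (Fin 3)) (fh : Fin F → (Fin k → ℝ))
      (z : Fin N → EuclideanSpace ℝ (Fin 3)),
      p t (⇑R ∘ zt) (⇑R ∘ fx, fh) (⇑R ∘ z) = p t zt (fx, fh) z)
    (m : (Fin N → EuclideanSpace ℝ (Fin 3)) → (Fin F → EuclideanSpace ℝ (Fin 3)) →
      (Fin F → (Fin k → ℝ)) → ℝ≥0∞)
    (hm : ∀ z0 fx fh, m z0 fx fh =
      ∫⁻ z : Fin T → (Fin N → EuclideanSpace ℝ (Fin 3)),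
        π (traj z0 z T) *
          ∏ t ∈ Finset.Icc 1 T, p t (traj z0 z t) (fx, fh) (traj z0 z (t - 1))) :
    ∀ (R : EuclideanSpace ℝ (Fin 3) ≃ₗᵢ[ℝ] EuclideanSpace ℝ (Fin 3))
      (z0 : Fin N → EuclideanSpace ℝ (Fin 3))
      (fx : Fin F → EuclideanSpace ℝ (Fin 3)) (fh : Fin F → (Fin k → ℝ)),
      m (⇑R ∘ z0) (⇑R ∘ fx) fh = m z0 fx fh := by
  intro R z0 fx fh
  have h1 : MeasurePreserving (fun (a : Fin N → EuclideanSpace ℝ (Fin 3)) (i : Fin N) => R (a i))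
      volume volume := volume_preserving_pi (fun _ => R.measurePreserving)
  have h2 : MeasurePreserving
      (fun (z : Fin T → (Fin N → EuclideanSpace ℝ (Fin 3))) (t : Fin T) => ⇑R ∘ z t)
      volume volume := volume_preserving_pi (fun _ => h1)
  have htm : ∀ (w : Fin N → EuclideanSpace ℝ (Fin 3)) (t : ℕ), Measurable
      (fun z : Fin T → (Fin N → EuclideanSpace ℝ (Fin 3)) => traj w z t) := by
    intro w t
    unfold traj
    split_ifs with h
    · exact measurable_pi_apply _
    · exact measurable_const
  have htr : ∀ (z : Fin T → (Fin N → EuclideanSpace ℝ (Fin 3))) (t : ℕ),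
      traj (⇑R ∘ z0) (fun t => ⇑R ∘ z t) t = ⇑R ∘ traj z0 z t := by
    intro z t
    unfold traj
    split_ifs <;> rfl
  rw [hm, hm, ← h2.lintegral_comp]
  · refine lintegral_congr fun z => ?_
    simp only [htr, hπinv, hpequiv]
  · refine (hπmeas.comp (htm _ T)).mul (Finset.measurable_prod _ fun t ht => ?_)
    rw [Finset.mem_Icc] at ht
    exact (hpmeas t ht.1 ht.2).comp
      ((htm _ t).prodMk (measurable_const.prodMk (htm _ (t - 1))))
end

section
/- For every m a : ℝ and v w : ℝ≥0, the measure (gaussianReal m v).bind (fun z => gaussianReal (a * z) w) equals gaussianReal (a * m) (⟨a^2, sq_nonneg a⟩ * v + w); that is, if Z is Gaussian with mean m and variance v, and conditionally on Z the variable X is Gaussian with mean a·Z and variance w, then X is Gaussian with mean a·m and variance a²·v + w. -/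
open MeasureTheory ProbabilityTheory

/-- if `Z ~ N(m, v)` and, conditionally on `Z`, `X ~ N(a·Z, w)`, then
`X ~ N(a·m, a²·v + w)`. -/
theorem gaussianReal_bind_gaussianReal (m a : ℝ) (v w : NNReal) :
    (gaussianReal m v).bind (fun z => gaussianReal (a * z) w) =
      gaussianReal (a * m) (⟨a ^ 2, sq_nonneg a⟩ * v + w) := by
  have key : ∀ (z : ℝ) (s : Set ℝ), MeasurableSet s →
      gaussianReal z w s = gaussianReal 0 w (Prod.mk z ⁻¹' ((fun p : ℝ × ℝ => p.1 + p.2) ⁻¹' s)) := by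
    intro z s hs
    have h := gaussianReal_map_const_add (μ := 0) (v := w) z
    rw [zero_add] at h
    rw [← h, Measure.map_apply (by fun_prop) hs]
    rfl
  have hadd : Measurable (fun p : ℝ × ℝ => p.1 + p.2) := by fun_prop
  have hm : Measurable (fun z : ℝ => gaussianReal z w) := by
    refine Measure.measurable_of_measurable_coe _ fun s hs => ?_
    simp_rw [key _ s hs]
    exact measurable_measure_prodMk_left (hadd hs)
  have hmul : Measurable (fun z : ℝ => a * z) := by fun_prop
  have h2 := gaussianReal_conv_gaussianReal (m₁ := a * m) (m₂ := 0)
    (v₁ := NNReal.mk (a ^ 2) (sq_nonneg a) * v) (v₂ := w)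
  rw [add_zero] at h2
  rw [← gaussianReal_map_const_mul] at h2
  refine Eq.trans ?_ h2
  have hc : Measurable (fun z : ℝ => gaussianReal (a * z) w) := hm.comp hmul
  ext s hs
  rw [Measure.bind_apply hs hc.aemeasurable, Measure.conv,
    Measure.map_apply hadd hs, Measure.prod_apply (hadd hs),
    lintegral_map (measurable_measure_prodMk_left (hadd hs)) hmul]
  exact lintegral_congr fun z => key _ s hs
end

section
/- Let z0 : ℝ and let β : ℕ → ℝ≥0 satisfy β t ≤ 1 for all t. Define a sequence of measures on ℝ by μ 0 = Measure.dirac z0 and μ (t+1) = (μ t).bind (fun z => gaussianReal (Real.sqrt (1 − (β (t+1) : ℝ)) * z) (β (t+1))). Then for every t : ℕ, μ t = gaussianReal (Real.sqrt (∏ s in Finset.Icc 1 t, (1 − (β s : ℝ))) * z0) (1 − ∏ s in Finset.Icc 1 t, (1 − β s)), where the variance is computed in ℝ≥0 (each factor 1 − β s lies in [0,1]). -/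
open MeasureTheory ProbabilityTheory

lemma gaussian_bind_aux (m c : ℝ) (v b : NNReal) :
    (gaussianReal m v).bind (fun z => gaussianReal (c * z) b)
      = gaussianReal (c * m) (NNReal.mk (c ^ 2) (sq_nonneg c) * v + b) := by
  have hmeas : Measurable (fun z : ℝ => gaussianReal (c * z) b) := by
    have h := measurable_gaussianReal
    exact h.comp (by fun_prop : Measurable (fun z : ℝ => (c * z, b)))
  have h1 : gaussianReal (c * m) (NNReal.mk (c ^ 2) (sq_nonneg c) * v + b)
      = ((gaussianReal m v).map (c * ·)).conv (gaussianReal 0 b) := by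
    rw [gaussianReal_map_const_mul, gaussianReal_conv_gaussianReal, add_zero]
  rw [h1]
  ext s hs
  rw [Measure.bind_apply hs hmeas.aemeasurable, ← lintegral_indicator_one hs,
    Measure.lintegral_conv (measurable_one.indicator hs),
    lintegral_map ?_ (by fun_prop)]
  · refine lintegral_congr fun z => ?_
    have h2 : gaussianReal (c * z) b = (gaussianReal 0 b).map ((c * z) + ·) := by
      rw [gaussianReal_map_const_add, zero_add]
    rw [h2, ← lintegral_indicator_one hs,
      lintegral_map (measurable_one.indicator hs) (by fun_prop)]
  · apply Measurable.lintegral_prod_right'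
      (f := fun p : ℝ × ℝ => s.indicator (1 : ℝ → ENNReal) (p.1 + p.2))
    exact (measurable_one.indicator hs).comp (by fun_prop)

/-- closed form of the Gaussian diffusion forward process: the time-`t`
law is Gaussian with mean `√(ᾱ_t)·z0` and variance `1 − ᾱ_t`, `ᾱ_t = ∏_{s=1}^t (1 − β_s)`. -/
theorem forward_diffusion_closed_form (z0 : ℝ) (β : ℕ → NNReal) (hβ : ∀ t, β t ≤ 1)
    (μ : ℕ → Measure ℝ)
    (hμ0 : μ 0 = Measure.dirac z0)
    (hμs : ∀ t : ℕ, μ (t + 1) = (μ t).bind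
      (fun z => gaussianReal (Real.sqrt (1 - (β (t + 1) : ℝ)) * z) (β (t + 1)))) :
    ∀ t : ℕ, μ t = gaussianReal
      (Real.sqrt (∏ s ∈ Finset.Icc 1 t, (1 - (β s : ℝ))) * z0)
      (1 - ∏ s ∈ Finset.Icc 1 t, (1 - β s)) := by
  have hb : ∀ t, 0 ≤ 1 - (β t : ℝ) := fun t => sub_nonneg.2 (by exact_mod_cast hβ t)
  intro t
  induction t with
  | zero => simp [hμ0]
  | succ t ih =>
    rw [hμs, ih, gaussian_bind_aux, Finset.prod_Icc_succ_top (by omega),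
      Finset.prod_Icc_succ_top (by omega), ← mul_assoc, mul_comm (∏ s ∈ _, (1 - (β s : ℝ))),
      Real.sqrt_mul (hb _)]
    congr 1
    have hP : ∏ s ∈ Finset.Icc 1 t, (1 - β s) ≤ 1 :=
      Finset.prod_le_one' fun i _ => tsub_le_self
    have hQ : (∏ s ∈ Finset.Icc 1 t, (1 - β s)) * (1 - β (t + 1)) ≤ 1 :=
      mul_le_one' hP tsub_le_self
    apply NNReal.eq
    rw [NNReal.coe_add, NNReal.coe_mul, NNReal.coe_mk, NNReal.coe_sub hP, NNReal.coe_sub hQ,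
      NNReal.coe_mul, NNReal.coe_sub (hβ _), Real.sq_sqrt (hb _), NNReal.coe_one]
    ring
end

section
/- Let ι be a finite type and for each i : ι let X i be a standard Borel measurable space with probability measures μ i and ν i on X i. Then klDiv (Measure.pi μ) (Measure.pi ν) = ∑ i, klDiv (μ i) (ν i), where Measure.pi μ and Measure.pi ν are the product probability measures on Π i, X i. -/
open MeasureTheory ProbabilityTheory Classical

/-- The Kullback–Leibler divergence of `μ` with respect to `ν`, valued in `ℝ≥0∞`:
`∫ log (dμ/dν) dμ` when `μ ≪ ν` and the log-likelihood ratio is `μ`-integrable,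
and `∞` otherwise. -/
noncomputable def klDiv {α : Type*} [MeasurableSpace α] (μ ν : Measure α) : ENNReal :=
  if μ ≪ ν ∧ Integrable (llr μ ν) μ then ENNReal.ofReal (∫ x, llr μ ν x ∂μ) else ⊤

theorem aux_klDiv_eq {α : Type*} [MeasurableSpace α] (μ ν : Measure α)
    [IsProbabilityMeasure μ] [IsProbabilityMeasure ν] :
    klDiv μ ν = InformationTheory.klDiv μ ν := by
  by_cases h : μ ≪ ν ∧ Integrable (llr μ ν) μ
  · rw [klDiv, if_pos h, InformationTheory.klDiv_of_ac_of_integrable h.1 h.2]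
    simp
  · rw [klDiv, if_neg h]
    symm
    rw [InformationTheory.klDiv_eq_top_iff]
    tauto

theorem aux_map {α β : Type*} [MeasurableSpace α] [MeasurableSpace β] (e : α ≃ᵐ β)
    (μ ν : Measure α) [IsFiniteMeasure μ] [IsFiniteMeasure ν] :
    InformationTheory.klDiv (μ.map e) (ν.map e) = InformationTheory.klDiv μ ν := by
  apply le_antisymm
  · exact InformationTheory.klDiv_map_le μ ν e.measurable
  · have h := InformationTheory.klDiv_map_le (μ.map e) (ν.map e) e.symm.measurable
    simpa using h

theorem aux_prod {α β : Type*} [MeasurableSpace α] [MeasurableSpace β]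
    (μ ν : Measure α) (μ' ν' : Measure β) [IsProbabilityMeasure μ] [IsProbabilityMeasure ν]
    [IsProbabilityMeasure μ'] [IsProbabilityMeasure ν'] :
    InformationTheory.klDiv (μ.prod μ') (ν.prod ν') =
      InformationTheory.klDiv μ ν + InformationTheory.klDiv μ' ν' := by
  have h1 := InformationTheory.klDiv_compProd_eq_add μ ν (Kernel.const α μ') (Kernel.const α ν')
  have h2 := InformationTheory.klDiv_compProd_left μ' ν' (Kernel.const β μ)
  have h3 := aux_map (MeasurableEquiv.prodComm (α := β) (β := α)) (μ'.prod μ) (ν'.prod μ)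
  simp only [Measure.compProd_const] at h1 h2
  have e1 : ∀ m : Measure β, [IsProbabilityMeasure m] →
      (m.prod μ).map (MeasurableEquiv.prodComm (α := β) (β := α)) = μ.prod m :=
    fun m _ => Measure.prod_swap
  rw [e1, e1] at h3
  rw [h1, h3, h2]

theorem aux_pi (ι : Type*) [Fintype ι] : ∀ (X : ι → Type*)
    [∀ i, MeasurableSpace (X i)]
    (μ ν : ∀ i, Measure (X i))
    [∀ i, IsProbabilityMeasure (μ i)] [∀ i, IsProbabilityMeasure (ν i)],
    InformationTheory.klDiv (Measure.pi μ) (Measure.pi ν) =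
      ∑ i, InformationTheory.klDiv (μ i) (ν i) := by
  refine Fintype.induction_empty_option (P := fun ι _ => ∀ (X : ι → Type _)
    [∀ i, MeasurableSpace (X i)]
    (μ ν : ∀ i, Measure (X i))
    [∀ i, IsProbabilityMeasure (μ i)] [∀ i, IsProbabilityMeasure (ν i)],
    InformationTheory.klDiv (Measure.pi μ) (Measure.pi ν) =
      ∑ i, InformationTheory.klDiv (μ i) (ν i)) ?_ ?_ ?_ ι
  · intro α β _ e ih X _ μ ν _ _
    letI := Fintype.ofEquiv β e.symm
    rw [← (measurePreserving_piCongrLeft μ e).map_eq, ← (measurePreserving_piCongrLeft ν e).map_eq,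
      aux_map, ← e.sum_comp]
    exact ih (fun i => X (e i)) (fun i => μ (e i)) (fun i => ν (e i))
  · intro X _ μ ν _ _
    have : Measure.pi μ = Measure.pi ν := by
      rw [Measure.pi_of_empty μ, Measure.pi_of_empty ν]
    rw [this]
    simp
  · intro α _ ih X _ μ ν _ _
    rw [← Measure.pi_map_piOptionEquivProd μ, ← Measure.pi_map_piOptionEquivProd ν, aux_map,
      aux_prod, ih, Fintype.sum_option, add_comm]

/-- tensorization (additivity over finite independent products) of the
Kullback–Leibler divergence. -/
theorem klDiv_pi {ι : Type*} [Fintype ι] {X : ι → Type*}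
    [∀ i, MeasurableSpace (X i)] [∀ i, StandardBorelSpace (X i)]
    (μ ν : ∀ i, Measure (X i))
    [∀ i, IsProbabilityMeasure (μ i)] [∀ i, IsProbabilityMeasure (ν i)] :
    klDiv (Measure.pi μ) (Measure.pi ν) = ∑ i, klDiv (μ i) (ν i) := by
  simp only [aux_klDiv_eq]
  exact aux_pi ι X μ ν
end
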